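/- arXiv:2007.04412 — 3 statements merged into one kernel-verified Lean document; each statement's English description precedes it below -/
import Mathlib

section
/- Let β : ℝ → ℝ be smooth with β(0) = β'(0) = β''(0) = 0 and β'''(0) = 6c₃ for some c₃ ≠ 0, let γ(t) = (t², β(t)), and for t ≠ 0 let κ(t) = ⟨γ''(t), γ'(t)^⊥⟩/|⟨γ'(t), γ'(t)⟩|^{3/2} = (−2β'(t) + 2t·β''(t))/| −4t² + β'(t)² |^{3/2} be the Minkowski curvature of γ. Then lim_{t→0, t≠0} |t|·κ(t) = 3c₃/4; in particular the curvature blows up like 3c₃/(4|t|) at the ordinary cusp. -/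
open Filter Topology

/-- If `f 0 = 0` and `f' = g` with `g t / t → a` at `0`, then `f t / t ^ 2 → a / 2`. -/
theorem tendsto_div_sq_of_hasDerivAt {f g : ℝ → ℝ} {a : ℝ} (hf : ∀ t, HasDerivAt f (g t) t)
    (hf0 : f 0 = 0) (hg : Tendsto (fun t => g t / t) (𝓝[≠] 0) (𝓝 a)) :
    Tendsto (fun t => f t / t ^ 2) (𝓝[≠] 0) (𝓝 (a / 2)) := by
  have hsq : ∀ t : ℝ, HasDerivAt (fun t : ℝ => t ^ 2) (2 * t) t := fun t => by
    simpa using hasDerivAt_pow 2 t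
  refine HasDerivAt.lhopital_zero_nhdsNE (f' := g) (g' := fun t => 2 * t)
    (.of_forall hf) (.of_forall hsq) ?_ ?_ ?_ ?_
  · filter_upwards [self_mem_nhdsWithin] with t ht
    exact mul_ne_zero two_ne_zero ht
  · simpa [hf0] using (hf 0).continuousAt.tendsto.mono_left nhdsWithin_le_nhds
  · simpa using (hsq 0).continuousAt.tendsto.mono_left nhdsWithin_le_nhds
  · refine (hg.div_const 2).congr fun t => ?_
    rw [div_div, mul_comm]

theorem abs_sq_mul_rpow_three_halves (t x : ℝ) :
    |t ^ 2 * x| ^ ((3 : ℝ) / 2) = |t| ^ 3 * |x| ^ ((3 : ℝ) / 2) := by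
  rw [abs_mul, Real.mul_rpow (abs_nonneg _) (abs_nonneg _), abs_pow, ← Real.rpow_natCast,
    ← Real.rpow_mul (abs_nonneg t), ← Real.rpow_natCast]
  norm_num

/-- At a non-lightlike ordinary cusp γ(t) = (t², β(t)) (β(0) = β'(0) = β''(0) = 0,
β'''(0) = 6c₃ ≠ 0), the Minkowski curvature blows up like 3c₃/(4|t|): |t|·κ(t) → 3c₃/4. -/
theorem stmt_13 (β : ℝ → ℝ) (hβ : ContDiff ℝ (⊤ : ℕ∞) β) (c₃ : ℝ) (hc₃ : c₃ ≠ 0)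
    (h0 : β 0 = 0) (h1 : deriv β 0 = 0) (h2 : iteratedDeriv 2 β 0 = 0)
    (h3 : iteratedDeriv 3 β 0 = 6 * c₃)
    (κ : ℝ → ℝ)
    (hκ : ∀ t, κ t = (-2 * deriv β t + 2 * t * iteratedDeriv 2 β t) /
        |(-4) * t^2 + (deriv β t)^2| ^ ((3:ℝ)/2)) :
    Tendsto (fun t => |t| * κ t) (𝓝[≠] (0:ℝ)) (𝓝 (3*c₃/4)) := by
  have hd1 : ∀ t, HasDerivAt (deriv β) (iteratedDeriv 2 β t) t := fun t => by
    have h := (hβ.differentiable_iteratedDeriv 1 (WithTop.coe_lt_coe.mpr (ENat.natCast_lt_top 1))) t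
    simpa [iteratedDeriv_succ] using h.hasDerivAt
  have hd2 : HasDerivAt (iteratedDeriv 2 β) (6 * c₃) 0 := by
    have h := (hβ.differentiable_iteratedDeriv 2 (WithTop.coe_lt_coe.mpr (ENat.natCast_lt_top 2))) 0
    rw [← h3, iteratedDeriv_succ (n := 2)]
    exact h.hasDerivAt
  have hg : Tendsto (fun t => iteratedDeriv 2 β t / t) (𝓝[≠] 0) (𝓝 (6 * c₃)) := by
    refine (hasDerivAt_iff_tendsto_slope.mp hd2).congr fun t => ?_
    simp [slope_def_field, h2]
  have hf := tendsto_div_sq_of_hasDerivAt hd1 h1 hg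
  have ht : Tendsto (fun t : ℝ => t) (𝓝[≠] 0) (𝓝 0) := nhdsWithin_le_nhds
  have hden : Tendsto (fun t => |(-4) + (deriv β t / t ^ 2 * t) ^ 2| ^ ((3 : ℝ) / 2))
      (𝓝[≠] 0) (𝓝 8) := by
    have h8 : |(-4 : ℝ) + (6 * c₃ / 2 * 0) ^ 2| ^ ((3 : ℝ) / 2) = 8 := by
      have h4 : |(-4 : ℝ) + (6 * c₃ / 2 * 0) ^ 2| = 2 ^ (2 : ℝ) := by norm_num
      rw [h4, ← Real.rpow_mul zero_le_two]
      norm_num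
    rw [← h8]
    exact (((hf.mul ht).pow 2).const_add (-4)).abs.rpow_const (Or.inr (by norm_num))
  have hlim := ((hf.const_mul (-2)).add (hg.const_mul 2)).div hden (by norm_num)
  rw [show 3 * c₃ / 4 = (-2 * (6 * c₃ / 2) + 2 * (6 * c₃)) / 8 by ring]
  refine hlim.congr' ?_
  filter_upwards [self_mem_nhdsWithin] with t (ht0 : t ≠ 0)
  have hfac : (-4) * t ^ 2 + deriv β t ^ 2 =
      t ^ 2 * ((-4) + (deriv β t / t ^ 2 * t) ^ 2) := by
    field_simp
  have hnum : -2 * deriv β t + 2 * t * iteratedDeriv 2 β t =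
      |t| ^ 2 * (-2 * (deriv β t / t ^ 2) + 2 * (iteratedDeriv 2 β t / t)) := by
    rw [sq_abs]
    field_simp
  have hat : |t| ≠ 0 := abs_ne_zero.mpr ht0
  rw [hκ, hfac, abs_sq_mul_rpow_three_halves, hnum, ← mul_div_assoc, ← mul_assoc,
    ← pow_succ', mul_div_mul_left _ _ (pow_ne_zero 3 hat)]
  rfl
end

section
/- Let β : ℝ → ℝ be smooth with β(0) = β'(0) = 0 and β''(0) = 2, and let γ(t) = (t², β(t)) (a curve with a lightlike singular point at t = 0 whose limiting tangent is the lightlike direction (1,1)). For u = (u₁,u₂) ∈ ℝ² let d_u(t) = −(t² − u₁)² + (β(t) − u₂)². Then d_u'(0) = 0 for every u, and d_u''(0) = 4u₁ − 4u₂; consequently {u ∈ ℝ² : d_u'(0) = d_u''(0) = 0} = {u ∈ ℝ² : u₁ = u₂}, so the lightlike tangent line u₁ = u₂ of γ at the singular point is contained in the caustic Bif(d) of γ. -/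
open Filter Topology

/-- First derivative of the distance squared function of the curve `t ↦ (t², β t)`. -/
theorem hasDerivAt_distSq {β : ℝ → ℝ} {b t : ℝ} (hβ : HasDerivAt β b t) (u : ℝ × ℝ) :
    HasDerivAt (fun t => -(t ^ 2 - u.1) ^ 2 + (β t - u.2) ^ 2)
      (-4 * t * (t ^ 2 - u.1) + 2 * (β t - u.2) * b) t := by
  have h := ((((hasDerivAt_id t).fun_pow 2).sub_const u.1).fun_pow 2).fun_neg.fun_add
    ((hβ.sub_const u.2).fun_pow 2)
  refine h.congr_deriv ?_
  simp
  ring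

/-- Second derivative of the distance squared function of the curve `t ↦ (t², β t)`. -/
theorem hasDerivAt_deriv_distSq {β β' : ℝ → ℝ} {c t : ℝ} (hβ : HasDerivAt β (β' t) t)
    (hβ' : HasDerivAt β' c t) (u : ℝ × ℝ) :
    HasDerivAt (fun t => -4 * t * (t ^ 2 - u.1) + 2 * (β t - u.2) * β' t)
      (-12 * t ^ 2 + 4 * u.1 + 2 * β' t ^ 2 + 2 * (β t - u.2) * c) t := by
  have h := (((hasDerivAt_id t).const_mul (-4)).fun_mul
    (((hasDerivAt_id t).fun_pow 2).sub_const u.1)).fun_add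
    (((hβ.sub_const u.2).const_mul 2).fun_mul hβ')
  refine h.congr_deriv ?_
  simp
  ring

/-- For γ(t) = (t², β(t)) with β(0) = β'(0) = 0 and β''(0) = 2 (lightlike singular point with
limiting tangent (1,1)), the distance squared family d_u(t) = -(t²-u₁)² + (β(t)-u₂)²
satisfies d_u'(0) = 0 and d_u''(0) = 4u₁ - 4u₂; hence the lightlike tangent line u₁ = u₂
is contained in the caustic of γ. -/
theorem stmt_15 (β : ℝ → ℝ) (hβ : ContDiff ℝ (⊤ : ℕ∞) β)
    (h0 : β 0 = 0) (h1 : deriv β 0 = 0) (h2 : iteratedDeriv 2 β 0 = 2)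
    (d : ℝ × ℝ → ℝ → ℝ)
    (hd : ∀ u t, d u t = -(t^2 - u.1)^2 + (β t - u.2)^2) :
    (∀ u : ℝ × ℝ, deriv (d u) 0 = 0 ∧ iteratedDeriv 2 (d u) 0 = 4 * u.1 - 4 * u.2) ∧
    {u : ℝ × ℝ | deriv (d u) 0 = 0 ∧ iteratedDeriv 2 (d u) 0 = 0} =
      {u : ℝ × ℝ | u.1 = u.2} := by
  have hdiff : Differentiable ℝ β := hβ.differentiable (by simp)
  have hdiff' : Differentiable ℝ (deriv β) := by
    have h : ContDiff ℝ 2 β := contDiff_infty.mp hβ 2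
    simpa using h.differentiable_iteratedDeriv 1 (by norm_num)
  have key : ∀ u : ℝ × ℝ,
      deriv (d u) 0 = 0 ∧ iteratedDeriv 2 (d u) 0 = 4 * u.1 - 4 * u.2 := by
    intro u
    have hderiv : deriv (d u) =
        fun t => -4 * t * (t ^ 2 - u.1) + 2 * (β t - u.2) * deriv β t := by
      rw [funext (hd u)]
      exact funext fun t => (hasDerivAt_distSq (hdiff t).hasDerivAt u).deriv
    have hβ2 : deriv (deriv β) 0 = 2 := by
      rw [← h2, iteratedDeriv_succ, iteratedDeriv_one]
    refine ⟨by simp [hderiv, h1], ?_⟩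
    rw [iteratedDeriv_succ, iteratedDeriv_one, hderiv,
      (hasDerivAt_deriv_distSq (hdiff 0).hasDerivAt (hdiff' 0).hasDerivAt u).deriv,
      h0, h1, hβ2]
    ring
  refine ⟨key, Set.ext fun u => ?_⟩
  simp only [Set.mem_ofPred_eq, key u, true_and]
  constructor <;> intro h <;> linarith
end

section
/- Let β : ℝ → ℝ be smooth with β(0) = β'(0) = 0, β''(0) = 2 and β'''(0) = 6c₃ for some c₃ ≠ 0, so that γ(t) = (t², β(t)) has a lightlike ordinary cusp at t = 0. Then β'(t) − t·β''(t) ≠ 0 for all sufficiently small t ≠ 0, and the branch u(t) = (u₁(t), u₂(t)) of the caustic of γ given by u₂(t) = β(t) − (t·β'(t)² − 4t³)/(β'(t) − t·β''(t)) and u₁(t) = 3t² − (β''(t)·(β(t) − u₂(t)) + β'(t)²)/2 satisfies lim_{t→0} u₁(t)/t² = 5, lim_{t→0} u₂(t)/t² = 5, and lim_{t→0} (u₁(t) − u₂(t))/t³ = 5c₃; in particular this branch itself has a lightlike ordinary cusp at the cusp point of γ, with lightlike limiting tangent direction (1,1). -/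
open Filter Topology

/-- If `f` vanishes at `0` and `f'(t) / tⁿ → L`, then `f(t) / tⁿ⁺¹ → L / (n + 1)`. -/
theorem tendsto_div_pow_succ_of_hasDerivAt {f f' : ℝ → ℝ} {n : ℕ} {L : ℝ}
    (hf : ∀ t, HasDerivAt f (f' t) t) (hf0 : f 0 = 0)
    (hL : Tendsto (fun t => f' t / t ^ n) (𝓝[≠] (0 : ℝ)) (𝓝 L)) :
    Tendsto (fun t => f t / t ^ (n + 1)) (𝓝[≠] (0 : ℝ)) (𝓝 (L / (n + 1))) := by
  have hn : (n : ℝ) + 1 ≠ 0 := by positivity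
  refine HasDerivAt.lhopital_zero_nhdsNE (f' := f') (g' := fun t => ((n : ℝ) + 1) * t ^ n)
    (Eventually.of_forall hf) (Eventually.of_forall fun t => ?_) ?_ ?_ ?_ ?_
  · simpa using hasDerivAt_pow (n + 1) t
  · filter_upwards [self_mem_nhdsWithin] with t ht
    exact mul_ne_zero hn (pow_ne_zero _ ht)
  · have h := (hf 0).continuousAt.tendsto
    rw [hf0] at h
    exact h.mono_left nhdsWithin_le_nhds
  · have h : Tendsto (fun t : ℝ => t ^ (n + 1)) (𝓝 0) (𝓝 (0 ^ (n + 1))) :=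
      (continuous_pow (n + 1)).tendsto 0
    rw [zero_pow n.succ_ne_zero] at h
    exact h.mono_left nhdsWithin_le_nhds
  · refine (hL.div_const ((n : ℝ) + 1)).congr fun t => ?_
    rw [div_div, mul_comm]

/-- At a lightlike ordinary cusp γ(t) = (t², β(t)) (β(0) = β'(0) = 0, β''(0) = 2,
β'''(0) = 6c₃ ≠ 0), the non-linear branch of the caustic satisfies u₁(t)/t² → 5,
u₂(t)/t² → 5 and (u₁(t) - u₂(t))/t³ → 5c₃: the branch itself has a lightlike ordinary
cusp at the cusp point with lightlike limiting tangent direction (1,1). -/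
theorem stmt_16 (β : ℝ → ℝ) (hβ : ContDiff ℝ (⊤ : ℕ∞) β) (c₃ : ℝ) (hc₃ : c₃ ≠ 0)
    (h0 : β 0 = 0) (h1 : deriv β 0 = 0) (h2 : iteratedDeriv 2 β 0 = 2)
    (h3 : iteratedDeriv 3 β 0 = 6 * c₃)
    (u₁ u₂ : ℝ → ℝ)
    (hu₂ : ∀ t, u₂ t = β t - (t * (deriv β t)^2 - 4*t^3) /
        (deriv β t - t * iteratedDeriv 2 β t))
    (hu₁ : ∀ t, u₁ t = 3*t^2 -
        (iteratedDeriv 2 β t * (β t - u₂ t) + (deriv β t)^2) / 2) :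
    (∀ᶠ t in 𝓝[≠] (0:ℝ), deriv β t - t * iteratedDeriv 2 β t ≠ 0) ∧
    Tendsto (fun t => u₁ t / t^2) (𝓝[≠] (0:ℝ)) (𝓝 5) ∧
    Tendsto (fun t => u₂ t / t^2) (𝓝[≠] (0:ℝ)) (𝓝 5) ∧
    Tendsto (fun t => (u₁ t - u₂ t) / t^3) (𝓝[≠] (0:ℝ)) (𝓝 (5*c₃)) := by
  have hd : ∀ k : ℕ, ∀ t, HasDerivAt (iteratedDeriv k β) (iteratedDeriv (k + 1) β t) t := by
    intro k t
    rw [iteratedDeriv_succ]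
    exact (hβ.differentiable_iteratedDeriv k
      (by exact_mod_cast WithTop.coe_lt_top _) t).hasDerivAt
  have hd0 : ∀ t, HasDerivAt β (deriv β t) t := fun t => by simpa using hd 0 t
  have hd1 : ∀ t, HasDerivAt (deriv β) (iteratedDeriv 2 β t) t := fun t => by
    simpa only [iteratedDeriv_one] using hd 1 t
  have hC : Tendsto (fun t => (iteratedDeriv 2 β t - 2) / t ^ 1) (𝓝[≠] (0 : ℝ))
      (𝓝 (6 * c₃)) := by
    have h := (hd 2 0).tendsto_slope_zero
    rw [h2, h3] at h
    refine h.congr fun t => ?_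
    simp [div_eq_inv_mul]
  have hB : Tendsto (fun t => (deriv β t - 2 * t) / t ^ 2) (𝓝[≠] (0 : ℝ))
      (𝓝 (3 * c₃)) := by
    have h := tendsto_div_pow_succ_of_hasDerivAt (f := fun t => deriv β t - 2 * t)
      (fun t => (hd1 t).sub (by simpa using (hasDerivAt_id t).const_mul 2)) (by simp [h1]) hC
    convert h using 2
    push_cast
    ring
  have hA : Tendsto (fun t => (β t - t ^ 2) / t ^ 3) (𝓝[≠] (0 : ℝ)) (𝓝 c₃) := by
    have h := tendsto_div_pow_succ_of_hasDerivAt (f := fun t => β t - t ^ 2)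
      (fun t => (hd0 t).sub (by simpa using hasDerivAt_pow 2 t)) (by simp [h0]) hB
    convert h using 2
    push_cast
    ring
  obtain ⟨A, hAdef⟩ : ∃ A : ℝ → ℝ, A = fun t => (β t - t ^ 2) / t ^ 3 := ⟨_, rfl⟩
  obtain ⟨B, hBdef⟩ : ∃ B : ℝ → ℝ, B = fun t => (deriv β t - 2 * t) / t ^ 2 := ⟨_, rfl⟩
  obtain ⟨C, hCdef⟩ : ∃ C : ℝ → ℝ, C = fun t => (iteratedDeriv 2 β t - 2) / t ^ 1 := ⟨_, rfl⟩
  rw [← hAdef] at hA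
  rw [← hBdef] at hB
  rw [← hCdef] at hC
  have eA : ∀ t, t ≠ 0 → β t = t ^ 2 + t ^ 3 * A t := fun t ht => by
    rw [hAdef]; field_simp; ring
  have eB : ∀ t, t ≠ 0 → deriv β t = 2 * t + t ^ 2 * B t := fun t ht => by
    rw [hBdef]; field_simp; ring
  have eC : ∀ t, t ≠ 0 → iteratedDeriv 2 β t = 2 + t * C t := fun t ht => by
    rw [hCdef]; field_simp; ring
  have hT : Tendsto (fun t : ℝ => t) (𝓝[≠] (0 : ℝ)) (𝓝 0) :=
    tendsto_id.mono_left nhdsWithin_le_nhds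
  have hBC : ∀ᶠ t in 𝓝[≠] (0 : ℝ), B t - C t ≠ 0 :=
    (hB.sub hC).eventually_ne (by intro h; apply hc₃; linarith)
  have hne : ∀ᶠ t in 𝓝[≠] (0 : ℝ), t ≠ 0 := self_mem_nhdsWithin
  obtain ⟨r, hr⟩ : ∃ r : ℝ → ℝ, r = fun t => B t * (4 + t * B t) / (B t - C t) := ⟨_, rfl⟩
  have hrlim : Tendsto r (𝓝[≠] (0 : ℝ)) (𝓝 (-4)) := by
    have hc : 3 * c₃ - 6 * c₃ ≠ 0 := by intro h; apply hc₃; linarith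
    have hlim : 3 * c₃ * (4 + 0 * (3 * c₃)) / (3 * c₃ - 6 * c₃) = -4 := by
      rw [div_eq_iff hc]; ring
    rw [hr, ← hlim]
    exact (hB.mul ((hT.mul hB).const_add 4)).div (hB.sub hC) hc
  have hden : ∀ t, t ≠ 0 → deriv β t - t * iteratedDeriv 2 β t = t ^ 2 * (B t - C t) :=
    fun t ht => by rw [eB t ht, eC t ht]; ring
  have e₂ : ∀ᶠ t in 𝓝[≠] (0 : ℝ), u₂ t = β t - t ^ 2 * r t := by
    filter_upwards [hBC, hne] with t hbc ht
    rw [hu₂, hden t ht, eB t ht, hr]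
    field_simp
    ring
  refine ⟨?_, ?_, ?_, ?_⟩
  · filter_upwards [hBC, hne] with t hbc ht
    rw [hden t ht]
    exact mul_ne_zero (pow_ne_zero _ ht) hbc
  · have h : Tendsto (fun t => 3 - ((2 + t * C t) * r t + (2 + t * B t) ^ 2) / 2)
        (𝓝[≠] (0 : ℝ)) (𝓝 (3 - ((2 + 0 * (6 * c₃)) * (-4) + (2 + 0 * (3 * c₃)) ^ 2) / 2)) :=
      (((((hT.mul hC).const_add 2).mul hrlim).add
        (((hT.mul hB).const_add 2).pow 2)).div_const 2).const_sub 3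
    rw [show (5 : ℝ) = 3 - ((2 + 0 * (6 * c₃)) * (-4) + (2 + 0 * (3 * c₃)) ^ 2) / 2 by ring]
    refine h.congr' ?_
    filter_upwards [e₂, hne] with t h₂ ht
    rw [hu₁, h₂, eB t ht, eC t ht]
    field_simp
    ring
  · have h : Tendsto (fun t => 1 + t * A t - r t) (𝓝[≠] (0 : ℝ))
        (𝓝 (1 + 0 * c₃ - (-4))) := ((hT.mul hA).const_add 1).sub hrlim
    rw [show (5 : ℝ) = 1 + 0 * c₃ - (-4) by ring]
    refine h.congr' ?_
    filter_upwards [e₂, hne] with t h₂ ht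
    rw [h₂, eA t ht]
    field_simp
  · have h : Tendsto (fun t => -A t - 2 * B t - t * B t ^ 2 / 2 - r t * C t / 2)
        (𝓝[≠] (0 : ℝ))
        (𝓝 (-c₃ - 2 * (3 * c₃) - 0 * (3 * c₃) ^ 2 / 2 - (-4) * (6 * c₃) / 2)) :=
      ((hA.neg.sub (hB.const_mul 2)).sub ((hT.mul (hB.pow 2)).div_const 2)).sub
        ((hrlim.mul hC).div_const 2)
    rw [show 5 * c₃ = -c₃ - 2 * (3 * c₃) - 0 * (3 * c₃) ^ 2 / 2 - (-4) * (6 * c₃) / 2 by ring]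
    refine h.congr' ?_
    filter_upwards [e₂, hne] with t h₂ ht
    rw [hu₁, h₂, eA t ht, eB t ht, eC t ht]
    field_simp
    ring
end
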